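/- For all six points x₁,…,x₆ ∈ ℂ³ the identity t₂t₃ = t₁t₄ − u + t₅(−t₀ + t₁ − t₂ − t₃ + t₄ − t₅) holds. -/

import Mathlib

/-- The bracket `[abc]`: determinant of the `3×3` matrix with rows `a, b, c`. -/
noncomputable def br (a b c : Fin 3 → ℂ) : ℂ := Matrix.det (Matrix.of ![a, b, c])

/-- `t₀ = [124][135][236]` (points indexed `0,…,5` for the paper's `1,…,6`). -/
noncomputable def t0 (x : Fin 6 → Fin 3 → ℂ) : ℂ :=
  br (x 0) (x 1) (x 3) * br (x 0) (x 2) (x 4) * br (x 1) (x 2) (x 5)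

/-- `t₁ = [123][135][246]` -/
noncomputable def t1 (x : Fin 6 → Fin 3 → ℂ) : ℂ :=
  br (x 0) (x 1) (x 2) * br (x 0) (x 2) (x 4) * br (x 1) (x 3) (x 5)

/-- `t₂ = [123][134][256]` -/
noncomputable def t2 (x : Fin 6 → Fin 3 → ℂ) : ℂ :=
  br (x 0) (x 1) (x 2) * br (x 0) (x 2) (x 3) * br (x 1) (x 4) (x 5)

/-- `t₃ = [123][125][346]` -/
noncomputable def t3 (x : Fin 6 → Fin 3 → ℂ) : ℂ :=
  br (x 0) (x 1) (x 2) * br (x 0) (x 1) (x 4) * br (x 2) (x 3) (x 5)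

/-- `t₄ = [123][124][356]` -/
noncomputable def t4 (x : Fin 6 → Fin 3 → ℂ) : ℂ :=
  br (x 0) (x 1) (x 2) * br (x 0) (x 1) (x 3) * br (x 2) (x 4) (x 5)

/-- `t₅ = [123][123][456]` -/
noncomputable def t5 (x : Fin 6 → Fin 3 → ℂ) : ℂ :=
  br (x 0) (x 1) (x 2) * br (x 0) (x 1) (x 2) * br (x 3) (x 4) (x 5)

/-- `u = [123][123][123][145][246][356]` -/
noncomputable def uInv (x : Fin 6 → Fin 3 → ℂ) : ℂ :=
  br (x 0) (x 1) (x 2) * br (x 0) (x 1) (x 2) * br (x 0) (x 1) (x 2) *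
    br (x 0) (x 3) (x 4) * br (x 1) (x 3) (x 5) * br (x 2) (x 4) (x 5)

theorem br_swap_left (a b c : Fin 3 → ℂ) : br b a c = -br a b c := by
  simp only [br, Matrix.det_fin_three, Matrix.of_apply, Matrix.cons_val]
  ring

/-- The three-term Grassmann–Plücker relation. -/
theorem br_mul_br (a b c p q : Fin 3 → ℂ) :
    br a b c * br a p q = br a b p * br a c q - br a c p * br a b q := by
  simp only [br, Matrix.det_fin_three, Matrix.of_apply, Matrix.cons_val]
  ring

/-- Cramer's rule: the expansion of `p` in `a`, `b`, `c`, inserted into `[pqr]`. -/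
theorem br_mul_br_eq_sum (a b c p q r : Fin 3 → ℂ) :
    br a b c * br p q r =
      br b c p * br a q r - br a c p * br b q r + br a b p * br c q r := by
  simp only [br, Matrix.det_fin_three, Matrix.of_apply, Matrix.cons_val]
  ring

theorem br_mul_br_second (a b c p q : Fin 3 → ℂ) :
    br a b c * br b p q = br a b p * br b c q - br b c p * br a b q := by
  linear_combination -br_mul_br b a c p q + br b p q * br_swap_left a b c -
    br b c q * br_swap_left a b p + br b c p * br_swap_left a b q

theorem br_mul_br_third (a b c p q : Fin 3 → ℂ) :
    br a b c * br c p q = br a c p * br b c q - br b c p * br a c q := by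
  have h := br_mul_br c a b p q
  have hD : br c a b = br a b c := by
    simp only [br, Matrix.det_fin_three, Matrix.of_apply, Matrix.cons_val]
    ring
  rw [hD, br_swap_left a c p, br_swap_left b c q, br_swap_left b c p, br_swap_left a c q] at h
  linear_combination h

theorem stmt_13 (x : Fin 6 → Fin 3 → ℂ) :
    t2 x * t3 x =
      t1 x * t4 x - uInv x +
        t5 x * (-t0 x + t1 x - t2 x - t3 x + t4 x - t5 x) := by
  simp only [t0, t1, t2, t3, t4, t5, uInv]
  generalize x 0 = a, x 1 = b, x 2 = c, x 3 = p, x 4 = q, x 5 = r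
  have hapq := br_mul_br a b c p q
  have haqr := br_mul_br a b c q r
  have hbpr := br_mul_br_second a b c p r
  have hbqr := br_mul_br_second a b c q r
  have hcpr := br_mul_br_third a b c p r
  have hcqr := br_mul_br_third a b c q r
  have hpqr : br a b c * br a b c * br p q r =
      br b c p * (br a b c * br a q r) - br a c p * (br a b c * br b q r) +
        br a b p * (br a b c * br c q r) := by
    linear_combination br a b c * br_mul_br_eq_sum a b c p q r
  rw [haqr, hbqr, hcqr] at hpqr
  have hu : br a b c * br a b c * br a b c * br a p q * br b p r * br c q r =
      (br a b c * br a p q) * (br a b c * br b p r) * (br a b c * br c q r) := by ring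
  rw [hu, hpqr, mul_right_comm _ (br a c q), mul_right_comm _ (br a c p),
    mul_right_comm _ (br a b q) (br c p r), mul_right_comm _ (br a b p) (br c q r),
    hapq, hbpr, hbqr, hcpr, hcqr]
  ring
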